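/- arXiv:0811.3752 — 9 statements merged into one kernel-verified Lean document; each statement's English description precedes it below -/
import Mathlib

section
/- Under the standing hypothesis, 𝒥(Id + ℐ) = ℐ on such Φ: for every y ∈ E, (𝒥(Φ + ℐΦ))(y) = (ℐΦ)(y), where Φ + ℐΦ denotes the pointwise sum. -/
open MeasureTheory Set

/-- Rescaling: `∫₀¹ f (s t) / s ds = ∫₀ᵗ f u / u du`. -/
lemma integral_comp_mul_div_eq_integral_div (f : ℝ → ℂ) {t : ℝ} (ht : t ≠ 0) :
    ∫ s in (0:ℝ)..1, f (s * t) / (s : ℂ) = ∫ u in (0:ℝ)..t, f u / (u : ℂ) := by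
  have h := intervalIntegral.smul_integral_comp_mul_right (a := 0) (b := 1)
    (fun u : ℝ => f u / (u : ℂ)) t
  rw [zero_mul, one_mul] at h
  rw [← h, ← intervalIntegral.integral_smul]
  congr 1 with s
  have ht' : (t : ℂ) ≠ 0 := by exact_mod_cast ht
  rw [Complex.real_smul, Complex.ofReal_mul, mul_div_assoc', mul_comm (s : ℂ),
    mul_div_mul_left _ _ ht']

/-- Integration by parts for `t ↦ t ∫₀ᵗ f u / u du`. -/
lemma integral_add_integral_div (f : ℝ → ℂ) (hf : Continuous f)
    (hint : IntervalIntegrable (fun u : ℝ => f u / (u : ℂ)) volume 0 1) :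
    ∫ t in (0:ℝ)..1, (f t + ∫ u in (0:ℝ)..t, f u / (u : ℂ)) =
      ∫ u in (0:ℝ)..1, f u / (u : ℂ) := by
  have hcont : ContinuousOn (fun t : ℝ => ∫ u in (0:ℝ)..t, f u / (u : ℂ)) (Icc 0 1) := by
    have := intervalIntegral.continuousOn_primitive_interval' hint left_mem_uIcc
    rwa [uIcc_of_le zero_le_one] at this
  have hderiv : ∀ t ∈ Ioo (0:ℝ) 1,
      HasDerivAt (fun t : ℝ => (t : ℂ) * ∫ u in (0:ℝ)..t, f u / (u : ℂ))
        (f t + ∫ u in (0:ℝ)..t, f u / (u : ℂ)) t := by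
    intro t ht
    have ht0 : (t : ℂ) ≠ 0 := by exact_mod_cast ht.1.ne'
    have hc : ∀ x ∈ Ioo (0:ℝ) 1, ContinuousAt (fun u : ℝ => f u / (u : ℂ)) x := fun x hx =>
      hf.continuousAt.div Complex.continuous_ofReal.continuousAt (by exact_mod_cast hx.1.ne')
    have hprim := intervalIntegral.integral_hasDerivAt_right
      (hint.mono_set (uIcc_subset_uIcc_left
        (by rw [uIcc_of_le zero_le_one]; exact Ioo_subset_Icc_self ht)))
      (ContinuousAt.stronglyMeasurableAtFilter isOpen_Ioo hc t ht) (hc t ht)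
    have hmul := (Complex.ofRealCLM.hasDerivAt (x := t)).mul hprim
    simp only [Complex.ofRealCLM_apply, Complex.ofReal_one, one_mul] at hmul
    rw [mul_div_cancel₀ _ ht0, add_comm] at hmul
    exact hmul
  have h := intervalIntegral.integral_eq_sub_of_hasDerivAt_of_le zero_le_one
    (Complex.continuous_ofReal.continuousOn.mul hcont) hderiv
    ((hf.continuousOn.add hcont).intervalIntegrable_of_Icc zero_le_one)
  simpa using h

/-- Under the standing hypothesis, `𝒥(Id + ℐ) = ℐ` on such `Φ`:
for every `y ∈ E`, `(𝒥(Φ + ℐΦ))(y) = (ℐΦ)(y)`, where `Φ + ℐΦ` denotes the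
pointwise sum. -/
theorem J_of_id_add_I_eq_I {E : Type*} [NormedAddCommGroup E] [NormedSpace ℝ E]
    (Φ : E → ℂ) (hΦ : Continuous Φ)
    (hint : ∀ y : E, IntegrableOn (fun s : ℝ => Φ (s • y) / (s : ℂ)) (Ioo 0 1)) :
    ∀ y : E,
      (∫ t in Ioo (0:ℝ) 1, (Φ (t • y) + ∫ s in Ioo (0:ℝ) 1, Φ (s • t • y) / (s : ℂ))) =
        ∫ s in Ioo (0:ℝ) 1, Φ (s • y) / (s : ℂ) := by
  intro y
  have h := integral_add_integral_div (fun s => Φ (s • y)) (by fun_prop)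
    ((intervalIntegrable_iff_integrableOn_Ioo_of_le zero_le_one).2 (hint y))
  simp only [intervalIntegral.integral_of_le (zero_le_one' ℝ), integral_Ioc_eq_integral_Ioo] at h
  rw [← h]
  refine setIntegral_congr_fun measurableSet_Ioo fun t ht => ?_
  have hscale := integral_comp_mul_div_eq_integral_div (fun s => Φ (s • y)) ht.1.ne'
  rw [intervalIntegral.integral_of_le zero_le_one, integral_Ioc_eq_integral_Ioo] at hscale
  simp only [smul_smul, hscale]
end

section
/- Under the standing hypothesis, ℐ(Id − 𝒥) = 𝒥 on such Φ: the function Ψ := Φ − 𝒥Φ satisfies that s ↦ Ψ(s•y)/s is integrable on (0,1) for every y ∈ E, and (ℐΨ)(y) = (𝒥Φ)(y) for every y ∈ E. -/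
open MeasureTheory Set

/-- The inverse square function is integrable away from the origin, with the expected integral. -/
lemma integrableOn_inv_sq_Ioo_and_integral {u : ℝ} (hu : u ∈ Ioo (0 : ℝ) 1) :
    IntegrableOn (fun s : ℝ => (s ^ 2)⁻¹) (Ioo u 1) ∧
      ∫ s in Ioo u 1, (s ^ 2)⁻¹ = u⁻¹ - 1 := by
  have hpos : ∀ s ∈ uIcc u 1, s ≠ 0 := fun s hs => by
    rw [uIcc_of_le hu.2.le] at hs
    exact (hu.1.trans_le hs.1).ne'
  have hint : IntervalIntegrable (fun s : ℝ => (s ^ 2)⁻¹) volume u 1 := by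
    refine ContinuousOn.intervalIntegrable fun s hs => ?_
    exact ((continuousAt_id.pow 2).inv₀ (pow_ne_zero 2 (hpos s hs))).continuousWithinAt
  refine ⟨(intervalIntegrable_iff_integrableOn_Ioo_of_le hu.2.le).1 hint, ?_⟩
  have hderiv : ∀ s ∈ uIcc u 1, HasDerivAt (fun s : ℝ => -s⁻¹) ((s ^ 2)⁻¹) s := fun s hs => by
    simpa using (hasDerivAt_inv (hpos s hs)).fun_neg
  rw [← integral_Ioc_eq_integral_Ioo, ← intervalIntegral.integral_of_le hu.2.le,
    intervalIntegral.integral_eq_sub_of_hasDerivAt hderiv hint]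
  simp
  ring

/-- Dilating the unit interval: `∫₀¹ f (t s) dt = s⁻¹ ∫₀ˢ f`. -/
lemma setIntegral_Ioo_comp_mul_right (f : ℝ → ℂ) {s : ℝ} (hs : 0 < s) :
    ∫ t in Ioo (0 : ℝ) 1, f (t * s) = s⁻¹ • ∫ u in Ioo 0 s, f u := by
  rw [← integral_Ioc_eq_integral_Ioo, ← integral_Ioc_eq_integral_Ioo,
    ← intervalIntegral.integral_of_le zero_le_one, ← intervalIntegral.integral_of_le hs.le,
    intervalIntegral.integral_comp_mul_right f hs.ne']
  simp

/-- If `f(s)/s` is integrable on `(0,1)`, then so is `f`. -/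
lemma integrableOn_Ioo_of_div {f : ℝ → ℂ}
    (hf : IntegrableOn (fun s : ℝ => f s / (s : ℂ)) (Ioo 0 1)) : IntegrableOn f (Ioo 0 1) := by
  have hbdd : IntegrableOn (fun s : ℝ => (s : ℂ) * (f s / (s : ℂ))) (Ioo 0 1) := by
    refine Integrable.bdd_mul (c := 1) hf Complex.continuous_ofReal.aestronglyMeasurable ?_
    filter_upwards [ae_restrict_mem measurableSet_Ioo] with s hs
    simpa [abs_of_pos hs.1] using hs.2.le
  refine hbdd.congr_fun (fun s hs => ?_) measurableSet_Ioo
  exact mul_div_cancel₀ _ (Complex.ofReal_ne_zero.2 hs.1.ne')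

/-- Hardy's averaging operator on `(0,1)` with respect to `ds/s`, computed by Fubini. -/
lemma integrableOn_average_div_and_integral {f : ℝ → ℂ}
    (hf : IntegrableOn (fun s : ℝ => f s / (s : ℂ)) (Ioo 0 1)) :
    IntegrableOn (fun s : ℝ => (∫ t in Ioo (0 : ℝ) 1, f (t * s)) / (s : ℂ)) (Ioo 0 1) ∧
      ∫ s in Ioo (0 : ℝ) 1, (∫ t in Ioo (0 : ℝ) 1, f (t * s)) / (s : ℂ) =
        (∫ s in Ioo (0 : ℝ) 1, f s / (s : ℂ)) - ∫ s in Ioo (0 : ℝ) 1, f s := by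
  have hf₁ := integrableOn_Ioo_of_div hf
  set μ : Measure ℝ := volume.restrict (Ioo 0 1) with hμ
  let k : ℝ → ℝ → ℝ := fun u s => (Ioi u).indicator (fun s => (s ^ 2)⁻¹) s
  have hk_nonneg : ∀ u s, 0 ≤ k u s := fun u s =>
    indicator_nonneg (fun s _ => by positivity) s
  have hk_meas : Measurable (fun p : ℝ × ℝ => k p.1 p.2) := by
    have : (fun p : ℝ × ℝ => k p.1 p.2) =
        {p : ℝ × ℝ | p.1 < p.2}.indicator (fun p => (p.2 ^ 2)⁻¹) := by
      ext p
      simp [k, indicator_apply]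
    rw [this]
    exact (by fun_prop : Measurable fun p : ℝ × ℝ => (p.2 ^ 2)⁻¹).indicator
      (measurableSet_lt measurable_fst measurable_snd)
  have hinter : ∀ u ∈ Ioo (0 : ℝ) 1, Ioi u ∩ Ioo (0 : ℝ) 1 = Ioo u 1 := fun u hu => by
    ext s
    simp only [mem_inter_iff, mem_Ioi, mem_Ioo]
    exact ⟨fun h => ⟨h.1, h.2.2⟩, fun h => ⟨h.1, hu.1.trans h.1, h.2⟩⟩
  have hk_int : ∀ u ∈ Ioo (0 : ℝ) 1, Integrable (k u) μ := fun u hu => by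
    rw [integrable_indicator_iff measurableSet_Ioi, IntegrableOn, hμ,
      Measure.restrict_restrict measurableSet_Ioi, hinter u hu]
    exact (integrableOn_inv_sq_Ioo_and_integral hu).1
  have hk_integral : ∀ u ∈ Ioo (0 : ℝ) 1, ∫ s, k u s ∂μ = u⁻¹ - 1 := fun u hu => by
    rw [integral_indicator measurableSet_Ioi, hμ,
      Measure.restrict_restrict measurableSet_Ioi, hinter u hu]
    exact (integrableOn_inv_sq_Ioo_and_integral hu).2
  have hprod : Integrable (Function.uncurry fun u s => k u s • f u) (μ.prod μ) := by
    refine (integrable_prod_iff ?_).2 ⟨?_, ?_⟩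
    · exact hk_meas.aestronglyMeasurable.smul hf₁.aestronglyMeasurable.comp_fst
    · filter_upwards [ae_restrict_mem measurableSet_Ioo] with u hu
      exact (hk_int u hu).smul_const (f u)
    · refine (hf.norm.sub hf₁.norm).congr ?_
      filter_upwards [ae_restrict_mem measurableSet_Ioo] with u hu
      simp only [Function.uncurry_apply_pair, norm_smul, Real.norm_of_nonneg (hk_nonneg _ _),
        integral_mul_const, hk_integral u hu, Pi.sub_apply, norm_div, Complex.norm_real,
        Real.norm_of_nonneg hu.1.le]
      ring
  have hinner : ∀ s ∈ Ioo (0 : ℝ) 1,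
      ∫ u, k u s • f u ∂μ = (∫ t in Ioo (0 : ℝ) 1, f (t * s)) / (s : ℂ) := fun s hs => by
    have hkf : (fun u => k u s • f u) = (Iio s).indicator fun u => (s ^ 2)⁻¹ • f u := by
      ext u
      by_cases h : u < s <;> simp [k, h]
    have hset : Iio s ∩ Ioo (0 : ℝ) 1 = Ioo 0 s := by
      ext u
      simp only [mem_inter_iff, mem_Iio, mem_Ioo]
      exact ⟨fun h => ⟨h.2.1, h.1⟩, fun h => ⟨h.2, h.1, h.2.trans hs.2⟩⟩
    rw [hkf, integral_indicator measurableSet_Iio, hμ,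
      Measure.restrict_restrict measurableSet_Iio, hset, integral_smul,
      setIntegral_Ioo_comp_mul_right f hs.1]
    simp only [Complex.real_smul, Complex.ofReal_inv, Complex.ofReal_pow]
    ring
  have hinner_ae : (fun s => ∫ u, k u s • f u ∂μ) =ᵐ[μ]
      fun s => (∫ t in Ioo (0 : ℝ) 1, f (t * s)) / (s : ℂ) := by
    filter_upwards [ae_restrict_mem measurableSet_Ioo] with s hs using hinner s hs
  refine ⟨hprod.integral_prod_right.congr hinner_ae, ?_⟩
  rw [← integral_congr_ae hinner_ae, ← integral_integral_swap hprod, ← integral_sub hf hf₁]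
  refine integral_congr_ae ?_
  filter_upwards [ae_restrict_mem measurableSet_Ioo] with u hu
  rw [integral_smul_const, hk_integral u hu]
  simp only [Complex.real_smul, Complex.ofReal_sub, Complex.ofReal_inv, Complex.ofReal_one]
  ring

/-- Under the standing hypothesis, `ℐ(Id − 𝒥) = 𝒥` on such `Φ`:
the function `Ψ := Φ − 𝒥Φ` satisfies that `s ↦ Ψ(s•y)/s` is integrable on
`(0,1)` for every `y ∈ E`, and `(ℐΨ)(y) = (𝒥Φ)(y)` for every `y ∈ E`. -/
theorem I_of_id_sub_J_eq_J {E : Type*} [NormedAddCommGroup E] [NormedSpace ℝ E]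
    (Φ : E → ℂ) (hΦ : Continuous Φ)
    (hint : ∀ y : E, IntegrableOn (fun s : ℝ => Φ (s • y) / (s : ℂ)) (Ioo 0 1))
    (Ψ : E → ℂ) (hΨ : Ψ = fun y => Φ y - ∫ s in Ioo (0:ℝ) 1, Φ (s • y)) :
    ∀ y : E,
      IntegrableOn (fun s : ℝ => Ψ (s • y) / (s : ℂ)) (Ioo 0 1) ∧
      (∫ s in Ioo (0:ℝ) 1, Ψ (s • y) / (s : ℂ)) = ∫ s in Ioo (0:ℝ) 1, Φ (s • y) := by
  intro y
  obtain ⟨hav, hav_eq⟩ := integrableOn_average_div_and_integral (f := fun s => Φ (s • y)) (hint y)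
  have hsplit : (fun s : ℝ => Ψ (s • y) / (s : ℂ)) = fun s : ℝ =>
      Φ (s • y) / (s : ℂ) - (∫ t in Ioo (0 : ℝ) 1, Φ ((t * s) • y)) / (s : ℂ) := by
    ext s
    simp only [hΨ, sub_div, mul_smul]
  rw [hsplit]
  refine ⟨(hint y).sub hav, ?_⟩
  rw [integral_sub (hint y) hav, hav_eq, sub_sub_cancel]
end

section
/- Under the standing hypothesis, (Id − 𝒥)(Id + ℐ) = Id on such Φ: the function Ψ := Φ + ℐΦ satisfies Ψ(y) − (𝒥Ψ)(y) = Φ(y) for every y ∈ E. -/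
open MeasureTheory Set

/-- Integration by parts for the primitive `G t = ∫₀ᵗ g u / u`: since `t * G t` has derivative
`g t + G t`, the integral of the latter over `[0, 1]` is `G 1`. -/
lemma integral_primitive_div_add_eq {g : ℝ → ℂ} (hg : Continuous g)
    (hint : IntervalIntegrable (fun u : ℝ => g u / (u : ℂ)) volume 0 1) :
    ∫ t in (0:ℝ)..1, (g t + ∫ u in (0:ℝ)..t, g u / (u : ℂ)) =
      ∫ u in (0:ℝ)..1, g u / (u : ℂ) := by
  have hG : ContinuousOn (fun t : ℝ => ∫ u in (0:ℝ)..t, g u / (u : ℂ)) (Icc 0 1) := by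
    have h := intervalIntegral.continuousOn_primitive_interval'
      hint (left_mem_uIcc (a := (0:ℝ)) (b := 1))
    rwa [uIcc_of_le zero_le_one] at h
  have key := intervalIntegral.integral_eq_sub_of_hasDerivAt_of_le
    (f := fun t : ℝ => (t : ℂ) * ∫ u in (0:ℝ)..t, g u / (u : ℂ))
    (f' := fun t : ℝ => g t + ∫ u in (0:ℝ)..t, g u / (u : ℂ)) zero_le_one
    (Complex.continuous_ofReal.continuousOn.mul hG) ?_ ?_
  · simpa using key
  · intro t ht
    have ht0 : (t : ℂ) ≠ 0 := Complex.ofReal_ne_zero.2 ht.1.ne'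
    have hcont : ContinuousAt (fun u : ℝ => g u / (u : ℂ)) t :=
      hg.continuousAt.div Complex.continuous_ofReal.continuousAt ht0
    have hmeas : Measurable (fun u : ℝ => g u / (u : ℂ)) :=
      hg.measurable.div Complex.measurable_ofReal
    have hsub : IntervalIntegrable (fun u : ℝ => g u / (u : ℂ)) volume 0 t :=
      hint.mono_set (by
        rw [uIcc_of_le ht.1.le, uIcc_of_le zero_le_one]
        exact Icc_subset_Icc_right ht.2.le)
    have hd := (HasDerivAt.ofReal_comp (hasDerivAt_id t)).mul
      (intervalIntegral.integral_hasDerivAt_right hsub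
        hmeas.stronglyMeasurable.stronglyMeasurableAtFilter hcont)
    refine hd.congr_deriv ?_
    simp only [id, Complex.ofReal_one, one_mul]
    rw [mul_div_cancel₀ _ ht0, add_comm]
  · refine ContinuousOn.intervalIntegrable ?_
    rw [uIcc_of_le zero_le_one]
    exact hg.continuousOn.add hG

/-- Scaling invariance of the measure `du / u`. -/
lemma integral_comp_mul_right_div (g : ℝ → ℂ) {t : ℝ} (ht : t ≠ 0) :
    ∫ s in (0:ℝ)..1, g (s * t) / (s : ℂ) = ∫ u in (0:ℝ)..t, g u / (u : ℂ) := by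
  have h := intervalIntegral.smul_integral_comp_mul_right
    (a := 0) (b := 1) (fun u : ℝ => g u / (u : ℂ)) t
  rw [zero_mul, one_mul, ← intervalIntegral.integral_smul] at h
  rw [← h]
  congr 1 with s
  have htc : (t : ℂ) ≠ 0 := Complex.ofReal_ne_zero.2 ht
  rw [Complex.real_smul, Complex.ofReal_mul, mul_comm (s : ℂ), ← mul_div_assoc,
    mul_div_mul_left _ _ htc]

/-- Under the standing hypothesis, `(Id − 𝒥)(Id + ℐ) = Id` on such
`Φ`: the function `Ψ := Φ + ℐΦ` satisfies `Ψ(y) − (𝒥Ψ)(y) = Φ(y)` for every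
`y ∈ E`. -/
theorem id_sub_J_of_id_add_I_eq_id {E : Type*} [NormedAddCommGroup E] [NormedSpace ℝ E]
    (Φ : E → ℂ) (hΦ : Continuous Φ)
    (hint : ∀ y : E, IntegrableOn (fun s : ℝ => Φ (s • y) / (s : ℂ)) (Ioo 0 1))
    (Ψ : E → ℂ) (hΨ : Ψ = fun y => Φ y + ∫ s in Ioo (0:ℝ) 1, Φ (s • y) / (s : ℂ)) :
    ∀ y : E, Ψ y - (∫ t in Ioo (0:ℝ) 1, Ψ (t • y)) = Φ y := by
  intro y
  have hset (f : ℝ → ℂ) : ∫ s in Ioo (0:ℝ) 1, f s = ∫ s in (0:ℝ)..1, f s := by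
    rw [intervalIntegral.integral_of_le zero_le_one, integral_Ioc_eq_integral_Ioo]
  have hg : Continuous fun t : ℝ => Φ (t • y) := by fun_prop
  have hJ : ∫ t in Ioo (0:ℝ) 1, Ψ (t • y) = ∫ s in Ioo (0:ℝ) 1, Φ (s • y) / (s : ℂ) := by
    have hpt : EqOn (fun t : ℝ => Ψ (t • y))
        (fun t => Φ (t • y) + ∫ u in (0:ℝ)..t, Φ (u • y) / (u : ℂ)) (Ioo 0 1) := by
      intro t ht
      simp only [hΨ, hset, smul_smul]
      rw [integral_comp_mul_right_div (fun s => Φ (s • y)) ht.1.ne']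
    rw [setIntegral_congr_fun measurableSet_Ioo hpt, hset, hset]
    exact integral_primitive_div_add_eq hg
      ((intervalIntegrable_iff_integrableOn_Ioo_of_le zero_le_one).2 (hint y))
  rw [hJ, hΨ]
  exact add_sub_cancel_right _ _
end

section
/- Under the standing hypothesis, the decomposition (Id − 𝒥)Φ + ℐ((Id − 𝒥)Φ) = Φ holds: for every y ∈ E, (Φ(y) − (𝒥Φ)(y)) + (ℐ(Φ − 𝒥Φ))(y) = Φ(y), and moreover (Φ(y) − (𝒥Φ)(y)) + (𝒥Φ)(y) = Φ(y), both summands being defined by absolutely convergent integrals. -/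
open MeasureTheory Set

section UnitAverage

variable {F : Type*} [NormedAddCommGroup F] [NormedSpace ℝ F]

/-- The averages `s ↦ ∫₀¹ f (t s) dt` of a continuous function depend continuously on `s`. -/
theorem continuous_unitAverage {f : ℝ → F} (hf : Continuous f) :
    Continuous fun s : ℝ => ∫ t in (0 : ℝ)..1, f (t * s) :=
  intervalIntegral.continuous_parametric_intervalIntegral_of_continuous'
    (f := fun s t : ℝ => f (t * s)) (by fun_prop) 0 1

theorem hasDerivAt_unitAverage [CompleteSpace F] {f : ℝ → F} (hf : Continuous f)
    {s : ℝ} (hs : s ≠ 0) :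
    HasDerivAt (fun s : ℝ => ∫ t in (0 : ℝ)..1, f (t * s))
      (s⁻¹ • (f s - ∫ t in (0 : ℝ)..1, f (t * s))) s := by
  have havg : ∀ u : ℝ, u ≠ 0 →
      ∫ t in (0 : ℝ)..1, f (t * u) = u⁻¹ • ∫ x in (0 : ℝ)..u, f x := fun u hu => by
    simp [intervalIntegral.integral_comp_mul_right f hu]
  have hprim : HasDerivAt (fun u : ℝ => ∫ x in (0 : ℝ)..u, f x) (f s) s :=
    (hf.integral_hasStrictDerivAt 0 s).hasDerivAt
  have hmul := (hasDerivAt_inv hs).smul hprim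
  refine (hmul.congr_of_eventuallyEq ?_).congr_deriv ?_
  · filter_upwards [isOpen_ne.mem_nhds hs] with u hu using havg u hu
  · rw [havg s hs, smul_sub, smul_smul, neg_smul, ← sub_eq_add_neg, sq, mul_inv]

/-- If `f` is continuous, nonnegative, and `f s / s` is integrable on `(0, 1)`, then so is the
average of `f` over `[0, s]` divided by `s`. -/
theorem integrableOn_inv_mul_unitAverage {f : ℝ → ℝ} (hf : Continuous f) (hnn : ∀ s, 0 ≤ f s)
    (hint : IntegrableOn (fun s : ℝ => s⁻¹ * f s) (Ioo 0 1)) :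
    IntegrableOn (fun s : ℝ => s⁻¹ * ∫ t in (0 : ℝ)..1, f (t * s)) (Ioo 0 1) := by
  have hIcc : IntegrableOn (fun s : ℝ => s⁻¹ * f s) (uIcc 0 1) := by
    rwa [uIcc_of_le zero_le_one, integrableOn_Icc_iff_integrableOn_Ioo]
  have hcont : ContinuousOn (fun s : ℝ => (∫ x in (0 : ℝ)..s, x⁻¹ * f x) -
      ∫ t in (0 : ℝ)..1, f (t * s)) (Icc 0 1) := by
    refine ContinuousOn.sub ?_ (continuous_unitAverage hf).continuousOn
    simpa [uIcc_of_le] using intervalIntegral.continuousOn_primitive_interval hIcc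
  rw [← integrableOn_Ioc_iff_integrableOn_Ioo]
  refine intervalIntegral.integrableOn_deriv_of_nonneg hcont (fun s hs => ?_) (fun s hs => ?_)
  · have hs0 : s ≠ 0 := hs.1.ne'
    have hII : IntervalIntegrable (fun x : ℝ => x⁻¹ * f x) volume 0 s :=
      (hIcc.mono_set (uIcc_subset_uIcc_left (by
        rw [uIcc_of_le zero_le_one]; exact Ioo_subset_Icc_self hs))).intervalIntegrable
    have hmeas : Measurable fun x : ℝ => x⁻¹ * f x := measurable_inv.mul hf.measurable
    have hprim := intervalIntegral.integral_hasDerivAt_right hII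
      (hmeas.stronglyMeasurable.stronglyMeasurableAtFilter)
      ((continuousAt_inv₀ hs0).mul hf.continuousAt)
    refine (hprim.sub (hasDerivAt_unitAverage hf hs0)).congr_deriv ?_
    simp only [smul_eq_mul]
    ring
  · exact mul_nonneg (inv_nonneg.2 hs.1.le)
      (intervalIntegral.integral_nonneg zero_le_one fun t _ => hnn _)

theorem integrableOn_inv_smul_unitAverage {f : ℝ → F} (hf : Continuous f)
    (hint : IntegrableOn (fun s : ℝ => s⁻¹ • f s) (Ioo 0 1)) :
    IntegrableOn (fun s : ℝ => s⁻¹ • ∫ t in (0 : ℝ)..1, f (t * s)) (Ioo 0 1) := by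
  have hnorm : IntegrableOn (fun s : ℝ => s⁻¹ * ‖f s‖) (Ioo 0 1) := by
    refine IntegrableOn.congr_fun hint.norm (fun s hs => ?_) measurableSet_Ioo
    simp [norm_smul, abs_of_pos hs.1]
  refine Integrable.mono'
    (integrableOn_inv_mul_unitAverage hf.norm (fun s => norm_nonneg _) hnorm) ?_ ?_
  · refine ContinuousOn.aestronglyMeasurable ?_ measurableSet_Ioo
    exact (continuousOn_inv₀.mono fun s hs => hs.1.ne').smul
      (continuous_unitAverage hf).continuousOn
  · filter_upwards [ae_restrict_mem measurableSet_Ioo] with s hs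
    rw [norm_smul, Real.norm_of_nonneg (inv_nonneg.2 hs.1.le)]
    exact mul_le_mul_of_nonneg_left
      (intervalIntegral.norm_integral_le_integral_norm zero_le_one) (inv_nonneg.2 hs.1.le)

theorem integrableOn_inv_smul_sub_unitAverage {f : ℝ → F} (hf : Continuous f)
    (hint : IntegrableOn (fun s : ℝ => s⁻¹ • f s) (Ioo 0 1)) :
    IntegrableOn (fun s : ℝ => s⁻¹ • (f s - ∫ t in (0 : ℝ)..1, f (t * s))) (Ioo 0 1) := by
  simp only [smul_sub]
  exact Integrable.sub hint (integrableOn_inv_smul_unitAverage hf hint)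

theorem integral_inv_smul_sub_unitAverage [CompleteSpace F] {f : ℝ → F} (hf : Continuous f)
    (hint : IntegrableOn (fun s : ℝ => s⁻¹ • f s) (Ioo 0 1)) :
    ∫ s in (0 : ℝ)..1, s⁻¹ • (f s - ∫ t in (0 : ℝ)..1, f (t * s)) =
      (∫ t in (0 : ℝ)..1, f t) - f 0 := by
  have hII := (intervalIntegrable_iff_integrableOn_Ioo_of_le zero_le_one).2
    (integrableOn_inv_smul_sub_unitAverage hf hint)
  rw [intervalIntegral.integral_eq_sub_of_hasDerivAt_of_le zero_le_one
    (continuous_unitAverage hf).continuousOn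
    (fun s hs => hasDerivAt_unitAverage hf hs.1.ne') hII]
  simp

end UnitAverage

/-- A constant `c` for which `c / s` is integrable on `(0, 1)` vanishes. -/
theorem eq_zero_of_integrableOn_const_div {c : ℂ}
    (h : IntegrableOn (fun s : ℝ => c / (s : ℂ)) (Ioo 0 1)) : c = 0 := by
  by_contra hc
  have hinv : IntegrableOn (fun s : ℝ => s⁻¹) (Ioo 0 1) := by
    refine IntegrableOn.congr_fun (h.norm.const_mul ‖c‖⁻¹) (fun s hs => ?_) measurableSet_Ioo
    have : ‖c‖ ≠ 0 := norm_ne_zero_iff.2 hc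
    simp only [norm_div, Complex.norm_real, Real.norm_of_nonneg hs.1.le]
    field_simp
  have hII := (intervalIntegrable_iff_integrableOn_Ioo_of_le zero_le_one).2 hinv
  simp [intervalIntegrable_inv_iff] at hII

/-- Under the standing hypothesis, the decomposition
`(Id − 𝒥)Φ + ℐ((Id − 𝒥)Φ) = Φ` holds: for every `y ∈ E`,
`(Φ(y) − (𝒥Φ)(y)) + (ℐ(Φ − 𝒥Φ))(y) = Φ(y)`, and moreover
`(Φ(y) − (𝒥Φ)(y)) + (𝒥Φ)(y) = Φ(y)`, both summands being defined by
absolutely convergent integrals. -/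
theorem selfdecomposable_decomposition {E : Type*} [NormedAddCommGroup E] [NormedSpace ℝ E]
    (Φ : E → ℂ) (hΦ : Continuous Φ)
    (hint : ∀ y : E, IntegrableOn (fun s : ℝ => Φ (s • y) / (s : ℂ)) (Ioo 0 1)) :
    ∀ y : E,
      IntegrableOn
        (fun s : ℝ => (Φ (s • y) - ∫ t in Ioo (0:ℝ) 1, Φ (t • s • y)) / (s : ℂ)) (Ioo 0 1) ∧
      (Φ y - ∫ t in Ioo (0:ℝ) 1, Φ (t • y)) +
        (∫ s in Ioo (0:ℝ) 1, (Φ (s • y) - ∫ t in Ioo (0:ℝ) 1, Φ (t • s • y)) / (s : ℂ)) =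
          Φ y ∧
      (Φ y - ∫ t in Ioo (0:ℝ) 1, Φ (t • y)) + (∫ t in Ioo (0:ℝ) 1, Φ (t • y)) = Φ y := by
  intro y
  have hdiv : ∀ (z : ℂ) (s : ℝ), z / (s : ℂ) = s⁻¹ • z := fun z s => by
    rw [Complex.real_smul, Complex.ofReal_inv, div_eq_inv_mul]
  have hIoo : ∀ g : ℝ → ℂ, ∫ t in Ioo (0 : ℝ) 1, g t = ∫ t in (0 : ℝ)..1, g t := fun g => by
    rw [intervalIntegral.integral_of_le zero_le_one, integral_Ioc_eq_integral_Ioo]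
  have hf : Continuous fun s : ℝ => Φ (s • y) := by fun_prop
  have hfint := hint y
  have hΦ0 : Φ 0 = 0 := eq_zero_of_integrableOn_const_div (by simpa using hint 0)
  simp only [hdiv, hIoo, smul_smul] at hfint ⊢
  refine ⟨integrableOn_inv_smul_sub_unitAverage hf hfint, ?_, sub_add_cancel _ _⟩
  rw [integral_inv_smul_sub_unitAverage hf hfint, zero_smul, hΦ0, sub_zero, sub_add_cancel]
end

section
/- Iterated identity: let k ≥ 1 and assume additionally that for every y ∈ E the function s ↦ Φ(s•y)·s⁻¹·(1 + log(1/s))^(k−1) is Lebesgue integrable on (0,1). Then all the iterates below are defined by absolutely convergent integrals and ℐ^(k−1)((Id − 𝒥)^k Φ) = (Id − 𝒥)(𝒥^(k−1) Φ) pointwise on E. -/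
open MeasureTheory Set

/-- The operator `𝒥`: `(𝒥Φ)(y) = ∫_(0,1) Φ(s•y) ds`. -/
noncomputable def Jop {E : Type*} [NormedAddCommGroup E] [NormedSpace ℝ E]
    (Φ : E → ℂ) : E → ℂ :=
  fun y => ∫ s in Ioo (0:ℝ) 1, Φ (s • y)

/-- The operator `ℐ`: `(ℐΦ)(y) = ∫_(0,1) Φ(s•y) s⁻¹ ds`. -/
noncomputable def Iop {E : Type*} [NormedAddCommGroup E] [NormedSpace ℝ E]
    (Φ : E → ℂ) : E → ℂ :=
  fun y => ∫ s in Ioo (0:ℝ) 1, Φ (s • y) / (s : ℂ)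

/-- `Φ` is continuous along every line through the origin and `s ↦ Φ(s•y)/s` is integrable on
`(0,1)` for every `y`. -/
structure RayAdmissible {E : Type*} [NormedAddCommGroup E] [NormedSpace ℝ E]
    (Φ : E → ℂ) : Prop where
  continuous_ray : ∀ y : E, Continuous fun t : ℝ => Φ (t • y)
  integrableOn_div : ∀ y : E, IntegrableOn (fun s : ℝ => Φ (s • y) / (s : ℂ)) (Ioo 0 1)

theorem integrableOn_Ioo_inv_sq {u : ℝ} (hu : 0 < u) :
    IntegrableOn (fun s : ℝ => (s ^ 2)⁻¹) (Ioo u 1) := by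
  refine (ContinuousOn.integrableOn_Icc ?_).mono_set Ioo_subset_Icc_self
  exact ContinuousOn.inv₀ (by fun_prop) fun s hs =>
    pow_ne_zero 2 (hu.trans_le hs.1).ne'

theorem integral_Ioo_inv_sq {u : ℝ} (hu : u ∈ Ioo (0 : ℝ) 1) :
    ∫ s in Ioo u 1, (s ^ 2)⁻¹ = u⁻¹ - 1 := by
  rw [← integral_Ioc_eq_integral_Ioo, ← intervalIntegral.integral_of_le hu.2.le]
  have hpos : ∀ s ∈ uIcc u 1, 0 < s := fun s hs => by
    rw [uIcc_of_le hu.2.le] at hs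
    exact hu.1.trans_le hs.1
  rw [intervalIntegral.integral_eq_sub_of_hasDerivAt (f := fun s => -s⁻¹)]
  · simp; ring
  · intro s hs
    exact (hasDerivAt_inv (hpos s hs).ne').neg.congr_deriv (neg_neg _)
  · refine ContinuousOn.intervalIntegrable (ContinuousOn.inv₀ (by fun_prop) fun s hs => ?_)
    have := hpos s hs
    positivity

/-- The average of `f` over `(0,s)`, divided by `s`, written as an integral over `(0,1)`. -/
theorem integral_comp_mul_div {f : ℝ → ℂ} {s : ℝ} (hs : s ∈ Ioo (0 : ℝ) 1) :
    (∫ t in Ioo (0 : ℝ) 1, f (t * s)) / (s : ℂ) =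
      ∫ u in Ioo (0 : ℝ) 1, (Iio s).indicator (fun u => f u * (((s ^ 2)⁻¹ : ℝ) : ℂ)) u := by
  have hset : Ioo (0 : ℝ) 1 ∩ Iio s = Ioo 0 s := by
    ext u
    simp only [mem_inter_iff, mem_Ioo, mem_Iio]
    exact ⟨fun h => ⟨h.1.1, h.2⟩, fun h => ⟨⟨h.1, h.2.trans hs.2⟩, h.2⟩⟩
  rw [setIntegral_indicator measurableSet_Iio, hset, integral_mul_const,
    ← integral_Ioc_eq_integral_Ioo, ← integral_Ioc_eq_integral_Ioo,
    ← intervalIntegral.integral_of_le zero_le_one, ← intervalIntegral.integral_of_le hs.1.le,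
    intervalIntegral.integral_comp_mul_right _ hs.1.ne']
  have : (s : ℂ) ≠ 0 := by exact_mod_cast hs.1.ne'
  simp only [zero_mul, one_mul, Complex.real_smul]
  push_cast
  field_simp

/-- Fubini for the averaging operator: the averages of `f` inherit integrability against `ds/s`,
with an explicit integral. -/
theorem integral_average_div {f : ℝ → ℂ} (hf : Continuous f)
    (hint : IntegrableOn (fun s : ℝ => f s / (s : ℂ)) (Ioo 0 1)) :
    IntegrableOn (fun s : ℝ => (∫ t in Ioo (0 : ℝ) 1, f (t * s)) / (s : ℂ)) (Ioo 0 1) ∧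
    ∫ s in Ioo (0 : ℝ) 1, (∫ t in Ioo (0 : ℝ) 1, f (t * s)) / (s : ℂ) =
      (∫ s in Ioo (0 : ℝ) 1, f s / (s : ℂ)) - ∫ s in Ioo (0 : ℝ) 1, f s := by
  set μ : Measure ℝ := volume.restrict (Ioo (0 : ℝ) 1) with hμ
  have hfi : IntegrableOn f (Ioo 0 1) :=
    (hf.integrableOn_Icc).mono_set Ioo_subset_Icc_self
  let h : ℝ × ℝ → ℂ :=
    {p : ℝ × ℝ | p.2 < p.1}.indicator fun p => f p.2 * (((p.1 ^ 2)⁻¹ : ℝ) : ℂ)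
  have hmeas : Measurable h :=
    Measurable.indicator (by have := hf.measurable; fun_prop)
      (measurableSet_lt measurable_snd measurable_fst)
  have hslice : ∀ s u, h (s, u) = (Ioi u).indicator (fun s => f u * (((s ^ 2)⁻¹ : ℝ) : ℂ)) s :=
    fun s u => rfl
  have hset : ∀ u ∈ Ioo (0 : ℝ) 1, Ioo (0 : ℝ) 1 ∩ Ioi u = Ioo u 1 := fun u hu => by
    ext s
    simp only [mem_inter_iff, mem_Ioo, mem_Ioi]
    exact ⟨fun h => ⟨h.2, h.1.2⟩, fun h => ⟨⟨hu.1.trans h.1, h.2⟩, h.1⟩⟩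
  have hprod : Integrable h (μ.prod μ) := by
    rw [integrable_prod_iff' hmeas.aestronglyMeasurable]
    constructor
    · refine (ae_restrict_mem measurableSet_Ioo).mono fun u hu => ?_
      simp only [hslice]
      rw [integrable_indicator_iff measurableSet_Ioi, IntegrableOn, hμ,
        Measure.restrict_restrict measurableSet_Ioi, inter_comm, hset u hu]
      exact (integrableOn_Ioo_inv_sq hu.1).ofReal.const_mul _
    · refine ((hint.norm).sub hfi.norm).congr ?_
      refine (ae_restrict_mem measurableSet_Ioo).mono fun u hu => ?_
      simp only [hslice, norm_indicator_eq_indicator_norm, Pi.sub_apply]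
      rw [hμ, setIntegral_indicator measurableSet_Ioi, hset u hu]
      simp only [norm_mul, Complex.norm_real, norm_inv, norm_pow, norm_div, Real.norm_eq_abs,
        sq_abs]
      rw [integral_const_mul, integral_Ioo_inv_sq hu, abs_of_pos hu.1]
      ring
  have hinner : (fun s : ℝ => ∫ u, h (s, u) ∂μ) =ᵐ[μ]
      fun s : ℝ => (∫ t in Ioo (0 : ℝ) 1, f (t * s)) / (s : ℂ) :=
    (ae_restrict_mem measurableSet_Ioo).mono fun s hs => (integral_comp_mul_div hs).symm
  refine ⟨hprod.integral_prod_left.congr hinner, ?_⟩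
  rw [← integral_congr_ae hinner, integral_integral_swap (f := fun s u => h (s, u)) hprod, ← integral_sub hint hfi]
  refine setIntegral_congr_fun measurableSet_Ioo fun u hu => ?_
  simp only [hslice]
  rw [hμ, setIntegral_indicator measurableSet_Ioi, hset u hu, integral_const_mul,
    integral_complex_ofReal, integral_Ioo_inv_sq hu]
  push_cast
  ring

section RayAdmissible

variable {E : Type*} [NormedAddCommGroup E] [NormedSpace ℝ E] {Φ : E → ℂ}

theorem Jop_smul (Φ : E → ℂ) (t : ℝ) (y : E) :
    Jop Φ (t • y) = ∫ s in Ioo (0 : ℝ) 1, Φ ((s * t) • y) := by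
  simp only [Jop, smul_smul]

theorem RayAdmissible.integrableOn (h : RayAdmissible Φ) (y : E) :
    IntegrableOn (fun s : ℝ => Φ (s • y)) (Ioo 0 1) :=
  ((h.continuous_ray y).integrableOn_Icc).mono_set Ioo_subset_Icc_self

theorem RayAdmissible.jop (h : RayAdmissible Φ) : RayAdmissible (Jop Φ) where
  continuous_ray y := by
    simp only [Jop_smul, ← integral_Ioc_eq_integral_Ioo,
      ← intervalIntegral.integral_of_le (zero_le_one' ℝ)]
    refine intervalIntegral.continuous_parametric_intervalIntegral_of_continuous'
      (f := fun t s : ℝ => Φ ((s * t) • y)) ?_ 0 1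
    exact (h.continuous_ray y).comp (continuous_snd.mul continuous_fst)
  integrableOn_div y := by
    simp only [Jop_smul]
    exact (integral_average_div (h.continuous_ray y) (h.integrableOn_div y)).1

theorem RayAdmissible.sub_jop (h : RayAdmissible Φ) : RayAdmissible (Φ - Jop Φ) where
  continuous_ray y := (h.continuous_ray y).sub (h.jop.continuous_ray y)
  integrableOn_div y := by
    simp only [Pi.sub_apply, sub_div]
    exact (h.integrableOn_div y).sub (h.jop.integrableOn_div y)

theorem RayAdmissible.iterate_jop (h : RayAdmissible Φ) (m : ℕ) :
    RayAdmissible (Jop^[m] Φ) :=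
  Function.Iterate.rec _ h (fun _ => RayAdmissible.jop) m

theorem RayAdmissible.iterate_sub_jop (h : RayAdmissible Φ) (m : ℕ) :
    RayAdmissible ((fun Ψ => Ψ - Jop Ψ)^[m] Φ) :=
  Function.Iterate.rec _ h (fun _ => RayAdmissible.sub_jop) m

theorem RayAdmissible.iop_sub_jop (h : RayAdmissible Φ) : Iop (Φ - Jop Φ) = Jop Φ := by
  ext y
  have hJ := integral_average_div (h.continuous_ray y) (h.integrableOn_div y)
  simp only [Iop, Pi.sub_apply, sub_div]
  rw [integral_sub (h.integrableOn_div y) (h.jop.integrableOn_div y)]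
  simp only [Jop_smul]
  rw [hJ.2, sub_sub_cancel, Jop]

theorem RayAdmissible.jop_sub_jop (h : RayAdmissible Φ) :
    Jop (Φ - Jop Φ) = Jop Φ - Jop (Jop Φ) := by
  ext y
  exact integral_sub (h.integrableOn y) (h.jop.integrableOn y)

theorem RayAdmissible.iterate_jop_sub_jop (h : RayAdmissible Φ) (m : ℕ) :
    Jop^[m] (Φ - Jop Φ) = Jop^[m] Φ - Jop (Jop^[m] Φ) := by
  induction m with
  | zero => rfl
  | succ m ih =>
    simp only [Function.iterate_succ_apply', ih]
    exact (h.iterate_jop m).jop_sub_jop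

theorem RayAdmissible.iterate_iop (h : RayAdmissible Φ) (m n : ℕ) :
    Iop^[m] ((fun Ψ => Ψ - Jop Ψ)^[m + n] Φ) = Jop^[m] ((fun Ψ => Ψ - Jop Ψ)^[n] Φ) := by
  induction m generalizing n with
  | zero => simp
  | succ m ih =>
    have hn := h.iterate_sub_jop n
    rw [Nat.add_right_comm, add_assoc, Function.iterate_succ_apply', ih,
      Function.iterate_succ_apply', hn.iterate_jop_sub_jop, (hn.iterate_jop m).iop_sub_jop,
      Function.iterate_succ_apply']

/-- Integrability with a logarithmic weight implies admissibility, since the weight is at least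
one on `(0,1)`. -/
theorem RayAdmissible.of_log_weight (hΦ : Continuous Φ) (n : ℕ)
    (hint : ∀ y : E,
      IntegrableOn
        (fun s : ℝ => Φ (s • y) / (s : ℂ) * ((1 + Real.log (1 / s) : ℝ) : ℂ) ^ n)
        (Ioo 0 1)) : RayAdmissible Φ where
  continuous_ray y := by fun_prop
  integrableOn_div y := by
    refine Integrable.mono (hint y) ?_ ?_
    · refine ContinuousOn.aestronglyMeasurable (fun s hs => ?_) measurableSet_Ioo
      refine ContinuousAt.continuousWithinAt (ContinuousAt.div (by fun_prop) (by fun_prop) ?_)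
      exact_mod_cast hs.1.ne'
    · refine (ae_restrict_mem measurableSet_Ioo).mono fun s hs => ?_
      have hlog : 0 ≤ Real.log (1 / s) := Real.log_nonneg (one_le_one_div hs.1 hs.2.le)
      rw [norm_mul, norm_pow, Complex.norm_real, Real.norm_of_nonneg (by positivity)]
      exact le_mul_of_one_le_right (norm_nonneg _) (one_le_pow₀ (by linarith))

end RayAdmissible

/-- Iterated identity: let `k ≥ 1` and assume additionally that for
every `y ∈ E` the function `s ↦ Φ(s•y)·s⁻¹·(1 + log(1/s))^(k−1)` is Lebesgue
integrable on `(0,1)`. Then all the iterates below are defined by absolutely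
convergent integrals and `ℐ^(k−1)((Id − 𝒥)^k Φ) = (Id − 𝒥)(𝒥^(k−1) Φ)`
pointwise on `E`. -/
theorem iterated_identity {E : Type*} [NormedAddCommGroup E] [NormedSpace ℝ E]
    (k : ℕ) (hk : 1 ≤ k) (Φ : E → ℂ) (hΦ : Continuous Φ)
    (hint : ∀ y : E,
      IntegrableOn
        (fun s : ℝ => Φ (s • y) / (s : ℂ) * ((1 + Real.log (1 / s) : ℝ) : ℂ) ^ (k - 1))
        (Ioo 0 1)) :
    (∀ m : ℕ, m < k → ∀ y : E,
      IntegrableOn (fun s : ℝ => ((fun Ψ => Ψ - Jop Ψ)^[m] Φ) (s • y)) (Ioo 0 1)) ∧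
    (∀ m : ℕ, m + 1 < k → ∀ y : E,
      IntegrableOn
        (fun s : ℝ => (Iop^[m] ((fun Ψ => Ψ - Jop Ψ)^[k] Φ)) (s • y) / (s : ℂ))
        (Ioo 0 1)) ∧
    ∀ y : E,
      (Iop^[k - 1] ((fun Ψ => Ψ - Jop Ψ)^[k] Φ)) y =
        (Jop^[k - 1] Φ) y - (Jop (Jop^[k - 1] Φ)) y := by
  have h := RayAdmissible.of_log_weight hΦ (k - 1) hint
  refine ⟨fun m _ y => (h.iterate_sub_jop m).integrableOn y, fun m hm y => ?_, fun y => ?_⟩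
  · obtain ⟨n, rfl⟩ := Nat.exists_eq_add_of_lt hm
    rw [add_assoc m, add_assoc m, h.iterate_iop]
    exact ((h.iterate_sub_jop _).iterate_jop m).integrableOn_div y
  · obtain ⟨n, rfl⟩ := Nat.exists_eq_add_of_le' hk
    rw [Nat.add_sub_cancel, h.iterate_iop, Function.iterate_one, h.iterate_jop_sub_jop,
      Pi.sub_apply]
end

section
/- Logarithmic moment of 𝒥M: the Tonelli-type identity ∫_(0,1) ( ∫_E 1{t‖x‖ > 1} · log(t‖x‖) dM(x) ) dt = ∫_{‖x‖>1} ( log‖x‖ − 1 + ‖x‖⁻¹ ) dM(x) holds in [0,∞] (note that log c − 1 + c⁻¹ ≥ 0 for c ≥ 1). In particular, if M({x : ‖x‖>1}) < ∞ and ∫_{‖x‖>1} log‖x‖ dM < ∞, then ∫_{‖x‖>1} log‖x‖ d(𝒥M) < ∞, where (𝒥M)(A) := ∫_(0,1) M(t⁻¹A) dt. -/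
open MeasureTheory Set

/-- On nonnegative arguments the positive part of `log` is carried by `(1, ∞)`. -/
lemma setLIntegral_ofReal_log_of_nonneg {α : Type*} [MeasurableSpace α] (μ : Measure α)
    {f : α → ℝ} (hf : Measurable f) (hf0 : ∀ x, 0 ≤ f x) :
    ∫⁻ x in {x | 1 < f x}, ENNReal.ofReal (Real.log (f x)) ∂μ =
      ∫⁻ x, ENNReal.ofReal (Real.log (f x)) ∂μ := by
  rw [← lintegral_indicator (measurableSet_lt measurable_const hf)]
  refine lintegral_congr fun x => ?_
  by_cases hx : 1 < f x
  · rw [indicator_of_mem (by exact hx)]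
  · rw [indicator_of_notMem (by exact hx),
      ENNReal.ofReal_of_nonpos (Real.log_nonpos (hf0 x) (not_lt.1 hx))]

lemma integral_log_mul_right {c : ℝ} (hc : 1 < c) :
    ∫ t in c⁻¹..1, Real.log (t * c) = Real.log c - 1 + c⁻¹ := by
  have hc0 : c ≠ 0 := by positivity
  rw [intervalIntegral.integral_comp_mul_right _ hc0, inv_mul_cancel₀ hc0, one_mul, integral_log]
  simp only [Real.log_one, smul_eq_mul]
  field_simp
  ring

lemma lintegral_Ioo_ofReal_log_mul {c : ℝ} (hc : 0 ≤ c) :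
    ∫⁻ t in Ioo (0 : ℝ) 1, ENNReal.ofReal (Real.log (t * c)) =
      {c : ℝ | 1 < c}.indicator (fun c => ENNReal.ofReal (Real.log c - 1 + c⁻¹)) c := by
  by_cases h : 1 < c
  · have hc0 : 0 < c := by positivity
    have hinv : c⁻¹ < 1 := inv_lt_one_of_one_lt₀ h
    have hone : ∀ t ∈ Ioc c⁻¹ 1, 1 ≤ t * c := fun t ht => by
      simpa [hc0.ne'] using mul_le_mul_of_nonneg_right ht.1.le hc
    have hint : IntervalIntegrable (fun t => Real.log (t * c)) volume c⁻¹ 1 := by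
      refine ContinuousOn.intervalIntegrable fun t ht => ?_
      rw [uIcc_of_le hinv.le] at ht
      have ht0 : 0 < t := (inv_pos.2 hc0).trans_le ht.1
      have : t * c ≠ 0 := by positivity
      exact ContinuousAt.continuousWithinAt (by fun_prop (disch := assumption))
    rw [indicator_of_mem (by exact h), ← integral_log_mul_right h,
      intervalIntegral.integral_of_le hinv.le,
      ofReal_integral_eq_lintegral_ofReal hint.1 ?_, setLIntegral_congr Ioo_ae_eq_Ioc,
      ← lintegral_indicator measurableSet_Ioc, ← lintegral_indicator measurableSet_Ioc]
    · refine lintegral_congr fun t => ?_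
      by_cases ht : t ∈ Ioc c⁻¹ 1
      · rw [indicator_of_mem ht,
          indicator_of_mem (show t ∈ Ioc 0 1 from ⟨(inv_pos.2 hc0).trans ht.1, ht.2⟩)]
      · rw [indicator_of_notMem ht]
        refine indicator_apply_eq_zero.2 fun ht' => ?_
        have hle : t ≤ c⁻¹ := not_lt.1 fun h' => ht ⟨h', ht'.2⟩
        refine ENNReal.ofReal_of_nonpos (Real.log_nonpos (mul_nonneg ht'.1.le hc) ?_)
        simpa [hc0.ne'] using mul_le_mul_of_nonneg_right hle hc
    · exact (ae_restrict_iff' measurableSet_Ioc).2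
        (Filter.Eventually.of_forall fun t ht => Real.log_nonneg (hone t ht))
  · rw [indicator_of_notMem (by exact h)]
    refine (setLIntegral_congr_fun measurableSet_Ioo fun t ht => ?_).trans lintegral_zero
    exact ENNReal.ofReal_of_nonpos (Real.log_nonpos (mul_nonneg ht.1.le hc)
      (mul_le_one₀ ht.2.le hc (not_lt.1 h)))

lemma lintegral_Ioo_lintegral_ofReal_log_mul_norm {E : Type*} [NormedAddCommGroup E]
    [MeasurableSpace E] [BorelSpace E] (M : Measure E) [SFinite M] :
    ∫⁻ t in Ioo (0 : ℝ) 1, ∫⁻ x, ENNReal.ofReal (Real.log (t * ‖x‖)) ∂M =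
      ∫⁻ x in {x : E | 1 < ‖x‖}, ENNReal.ofReal (Real.log ‖x‖ - 1 + ‖x‖⁻¹) ∂M := by
  rw [lintegral_lintegral_swap (by fun_prop),
    ← lintegral_indicator (measurableSet_lt measurable_const measurable_norm)]
  exact lintegral_congr fun x => lintegral_Ioo_ofReal_log_mul (norm_nonneg x)

lemma measurable_map_smul {E : Type*} [NormedAddCommGroup E] [NormedSpace ℝ E]
    [SecondCountableTopology E] [MeasurableSpace E] [BorelSpace E] (M : Measure E) [SFinite M] :
    Measurable fun t : ℝ => M.map fun x : E => t • x := by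
  refine Measure.measurable_of_measurable_coe _ fun s hs => ?_
  have hmeas : Measurable fun p : ℝ × E => p.1 • p.2 := by fun_prop
  simp_rw [Measure.map_apply (measurable_const_smul (_ : ℝ)) hs]
  exact measurable_measure_prodMk_left (hmeas hs)

/-- Logarithmic moment of `𝒥M`: the Tonelli-type identity
`∫_(0,1) ( ∫_E 1{t‖x‖ > 1} · log(t‖x‖) dM(x) ) dt
  = ∫_{‖x‖>1} ( log‖x‖ − 1 + ‖x‖⁻¹ ) dM(x)`
holds in `[0,∞]`. In particular, if `M({x : ‖x‖>1}) < ∞` and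
`∫_{‖x‖>1} log‖x‖ dM < ∞`, then `∫_{‖x‖>1} log‖x‖ d(𝒥M) < ∞`, where
`(𝒥M)(A) := ∫_(0,1) M(t⁻¹A) dt`, i.e. `𝒥M` is the mixture over `t ∈ (0,1)` of
the image measures of `M` under `x ↦ t•x`. -/
theorem log_moment_JM {E : Type*} [NormedAddCommGroup E] [NormedSpace ℝ E]
    [CompleteSpace E] [SecondCountableTopology E] [MeasurableSpace E] [BorelSpace E]
    (M : Measure E) [SigmaFinite M] :
    (∫⁻ t in Ioo (0:ℝ) 1,
        ∫⁻ x in {x : E | 1 < t * ‖x‖}, ENNReal.ofReal (Real.log (t * ‖x‖)) ∂M) =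
      ∫⁻ x in {x : E | 1 < ‖x‖},
        ENNReal.ofReal (Real.log ‖x‖ - 1 + ‖x‖⁻¹) ∂M ∧
    (M {x : E | 1 < ‖x‖} < ⊤ →
      (∫⁻ x in {x : E | 1 < ‖x‖}, ENNReal.ofReal (Real.log ‖x‖) ∂M) < ⊤ →
      (∫⁻ x in {x : E | 1 < ‖x‖}, ENNReal.ofReal (Real.log ‖x‖)
        ∂((volume.restrict (Ioo (0:ℝ) 1)).bind
            (fun t : ℝ => Measure.map (fun x : E => t • x) M))) < ⊤) := by
  have key := lintegral_Ioo_lintegral_ofReal_log_mul_norm M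
  refine ⟨?_, fun _ hlog => ?_⟩
  · rw [← key]
    exact setLIntegral_congr_fun measurableSet_Ioo fun t ht =>
      setLIntegral_ofReal_log_of_nonneg M (by fun_prop)
        fun x => mul_nonneg ht.1.le (norm_nonneg x)
  · have hmeas : Measurable fun x : E => ENNReal.ofReal (Real.log ‖x‖) := by fun_prop
    rw [setLIntegral_ofReal_log_of_nonneg _ measurable_norm norm_nonneg,
      Measure.lintegral_bind (measurable_map_smul M).aemeasurable hmeas.aemeasurable]
    have hbind : ∫⁻ t in Ioo (0 : ℝ) 1, ∫⁻ x, ENNReal.ofReal (Real.log ‖x‖)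
          ∂(M.map fun x : E => t • x) =
        ∫⁻ t in Ioo (0 : ℝ) 1, ∫⁻ x, ENNReal.ofReal (Real.log (t * ‖x‖)) ∂M := by
      refine setLIntegral_congr_fun measurableSet_Ioo fun t ht => ?_
      simp only [lintegral_map hmeas (measurable_const_smul t), norm_smul,
        Real.norm_of_nonneg ht.1.le]
    rw [hbind, key]
    refine lt_of_le_of_lt (setLIntegral_mono hmeas fun x hx => ?_) hlog
    exact ENNReal.ofReal_le_ofReal (by linarith [inv_le_one_of_one_le₀ (show 1 < ‖x‖ from hx).le])
end

section
/- Logarithmic moment of ℐM: the Tonelli-type identity ∫_(0,∞) ( ∫_E 1{‖x‖ > e^t} · ( log‖x‖ − t ) dM(x) ) dt = (1/2) · ∫_{‖x‖>1} (log‖x‖)² dM(x) holds in [0,∞]. In particular, if ∫_{‖x‖>1} (log‖x‖)² dM < ∞, then ∫_{‖x‖>1} log‖x‖ d(ℐM) < ∞, where (ℐM)(A) := ∫_(0,1) M(t⁻¹A) t⁻¹ dt = ∫_(0,∞) M(e^t A) dt. -/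
open MeasureTheory Set
open scoped ENNReal

theorem lintegral_Ioi_ofReal_sub {L : ℝ} (hL : 0 ≤ L) :
    ∫⁻ t in Ioi (0 : ℝ), ENNReal.ofReal (L - t) = 1 / 2 * ENNReal.ofReal (L ^ 2) := by
  have hsplit : ∫⁻ t in Ioi (0 : ℝ), ENNReal.ofReal (L - t) =
      ∫⁻ t in Ioc 0 L, ENNReal.ofReal (L - t) := by
    rw [← Ioc_union_Ioi_eq_Ioi hL,
      lintegral_union measurableSet_Ioi (Ioc_disjoint_Ioi le_rfl),
      setLIntegral_congr_fun (g := fun _ => 0) measurableSet_Ioi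
        (fun t (ht : L < t) => ENNReal.ofReal_of_nonpos (by linarith))]
    simp
  have hint : ∫ t in (0 : ℝ)..L, (L - t) = 1 / 2 * L ^ 2 := by
    rw [intervalIntegral.integral_sub (by simp) (by simp)]
    simp only [intervalIntegral.integral_const, integral_id, smul_eq_mul]
    ring
  rw [hsplit, ← ofReal_integral_eq_lintegral_ofReal, ← intervalIntegral.integral_of_le hL, hint,
    ENNReal.ofReal_mul (by norm_num), ENNReal.ofReal_div_of_pos (by norm_num)]
  · simp
  · exact (by fun_prop : Continuous fun t : ℝ => L - t).integrableOn_Ioc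
  · exact (ae_restrict_iff' measurableSet_Ioc).2
      (.of_forall fun t ht => sub_nonneg.2 ht.2)

section

variable {E : Type*} [NormedAddCommGroup E] [MeasurableSpace E]

theorem setLIntegral_exp_lt_norm_log_sub [OpensMeasurableSpace E] (M : Measure E) {t : ℝ}
    (ht : 0 < t) :
    ∫⁻ x in {x : E | Real.exp t < ‖x‖}, ENNReal.ofReal (Real.log ‖x‖ - t) ∂M =
      ∫⁻ x in {x : E | 1 < ‖x‖}, ENNReal.ofReal (Real.log ‖x‖ - t) ∂M := by
  rw [← lintegral_indicator (measurableSet_lt measurable_const measurable_norm),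
    ← lintegral_indicator (measurableSet_lt measurable_const measurable_norm)]
  congr 1 with x
  simp only [indicator_apply, mem_ofPred_eq]
  by_cases h1 : 1 < ‖x‖
  · by_cases h2 : Real.exp t < ‖x‖
    · simp [h1, h2]
    · have : Real.log ‖x‖ ≤ t := (Real.log_le_iff_le_exp (by linarith)).2 (not_lt.1 h2)
      simp [h2, this]
  · have h2 : ¬ Real.exp t < ‖x‖ := fun h => h1 ((Real.one_lt_exp_iff.2 ht).trans h)
    simp [h1, h2]

theorem lintegral_setLIntegral_exp_lt_norm_log_sub [OpensMeasurableSpace E]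
    (M : Measure E) [SFinite M] :
    (∫⁻ t in Ioi (0:ℝ),
        ∫⁻ x in {x : E | Real.exp t < ‖x‖}, ENNReal.ofReal (Real.log ‖x‖ - t) ∂M) =
      (1 / 2 : ℝ≥0∞) *
        ∫⁻ x in {x : E | 1 < ‖x‖}, ENNReal.ofReal ((Real.log ‖x‖) ^ 2) ∂M := by
  rw [setLIntegral_congr_fun measurableSet_Ioi
      (fun t (ht : 0 < t) => setLIntegral_exp_lt_norm_log_sub M ht),
    lintegral_lintegral_swap (Measurable.aemeasurable (by fun_prop)),
    ← lintegral_const_mul _ (by fun_prop)]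
  exact setLIntegral_congr_fun (measurableSet_lt measurable_const measurable_norm)
    fun x (hx : 1 < ‖x‖) => lintegral_Ioi_ofReal_sub (Real.log_nonneg hx.le)

variable [NormedSpace ℝ E] [BorelSpace E]

theorem measurable_map_exp_neg_smul [SecondCountableTopology E] (M : Measure E) [SFinite M] :
    Measurable fun t : ℝ => Measure.map (fun x : E => Real.exp (-t) • x) M := by
  refine Measure.measurable_of_measurable_coe _ fun s hs => ?_
  have hsmul : Measurable fun p : ℝ × E => Real.exp (-p.1) • p.2 := by fun_prop
  have := measurable_measure_prodMk_left (ν := M) (hsmul hs)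
  convert this using 2 with t
  exact Measure.map_apply (by fun_prop) hs

theorem setLIntegral_log_norm_map_exp_neg_smul (M : Measure E) (t : ℝ) :
    ∫⁻ x in {x : E | 1 < ‖x‖}, ENNReal.ofReal (Real.log ‖x‖)
        ∂(Measure.map (fun x : E => Real.exp (-t) • x) M) =
      ∫⁻ x in {x : E | Real.exp t < ‖x‖}, ENNReal.ofReal (Real.log ‖x‖ - t) ∂M := by
  rw [setLIntegral_map (measurableSet_lt measurable_const measurable_norm) (by fun_prop)
    (by fun_prop)]
  have hnorm (x : E) : ‖Real.exp (-t) • x‖ = Real.exp (-t) * ‖x‖ := by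
    rw [norm_smul, Real.norm_of_nonneg (Real.exp_nonneg _)]
  have hset : (fun x : E => Real.exp (-t) • x) ⁻¹' {x : E | 1 < ‖x‖} =
      {x : E | Real.exp t < ‖x‖} := by
    ext x
    simp only [mem_preimage, mem_ofPred_eq, hnorm]
    rw [Real.exp_neg, lt_inv_mul_iff₀ (Real.exp_pos t), mul_one]
  rw [hset]
  refine setLIntegral_congr_fun (measurableSet_lt measurable_const measurable_norm)
    fun x (hx : Real.exp t < ‖x‖) => ?_
  have hpos : 0 < ‖x‖ := (Real.exp_pos t).trans hx
  rw [hnorm, Real.log_mul (Real.exp_ne_zero _) hpos.ne', Real.log_exp, neg_add_eq_sub]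

end

/-- Logarithmic moment of `ℐM`: the Tonelli-type identity
`∫_(0,∞) ( ∫_E 1{‖x‖ > e^t} · ( log‖x‖ − t ) dM(x) ) dt
  = (1/2) · ∫_{‖x‖>1} (log‖x‖)² dM(x)`
holds in `[0,∞]`. In particular, if `∫_{‖x‖>1} (log‖x‖)² dM < ∞`, then
`∫_{‖x‖>1} log‖x‖ d(ℐM) < ∞`, where
`(ℐM)(A) := ∫_(0,1) M(t⁻¹A) t⁻¹ dt = ∫_(0,∞) M(e^t A) dt`, i.e. `ℐM` is the
mixture over `t ∈ (0,∞)` of the image measures of `M` under `x ↦ e^(−t)•x`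
(so that `(ℐM)(A) = ∫_(0,∞) M(e^t A) dt`). -/
theorem log_moment_IM {E : Type*} [NormedAddCommGroup E] [NormedSpace ℝ E]
    [CompleteSpace E] [SecondCountableTopology E] [MeasurableSpace E] [BorelSpace E]
    (M : Measure E) [SigmaFinite M] :
    (∫⁻ t in Ioi (0:ℝ),
        ∫⁻ x in {x : E | Real.exp t < ‖x‖}, ENNReal.ofReal (Real.log ‖x‖ - t) ∂M) =
      (1 / 2 : ℝ≥0∞) *
        ∫⁻ x in {x : E | 1 < ‖x‖}, ENNReal.ofReal ((Real.log ‖x‖) ^ 2) ∂M ∧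
    ((∫⁻ x in {x : E | 1 < ‖x‖}, ENNReal.ofReal ((Real.log ‖x‖) ^ 2) ∂M) < ⊤ →
      (∫⁻ x in {x : E | 1 < ‖x‖}, ENNReal.ofReal (Real.log ‖x‖)
        ∂((volume.restrict (Ioi (0:ℝ))).bind
            (fun t : ℝ => Measure.map (fun x : E => Real.exp (-t) • x) M))) < ⊤) := by
  refine ⟨lintegral_setLIntegral_exp_lt_norm_log_sub M, fun hfin => ?_⟩
  have hA : MeasurableSet {x : E | 1 < ‖x‖} := measurableSet_lt measurable_const measurable_norm
  have hg : Measurable fun x : E => ENNReal.ofReal (Real.log ‖x‖) := by fun_prop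
  rw [← lintegral_indicator hA, Measure.lintegral_bind (measurable_map_exp_neg_smul M).aemeasurable
    (hg.indicator hA).aemeasurable]
  simp_rw [lintegral_indicator hA, setLIntegral_log_norm_map_exp_neg_smul]
  rw [lintegral_setLIntegral_exp_lt_norm_log_sub]
  exact ENNReal.mul_lt_top (by simp) hfin
end

section
/- Intermediate identity in the proof of finiteness of the logarithmic moment: assume M({x : ‖x‖>1}) < ∞ and let M̃ be a Borel measure on E such that M(A) = M̃(A) + ∫_(0,1) M(t⁻¹A) dt for every Borel set A. Then for every k > 1, ∫_{1<‖x‖≤k} log‖x‖ dM̃ = ∫_{1<‖x‖≤k} (1 − ‖x‖⁻¹) dM − (k·log k − k + 1) · ∫_{‖x‖>k} ‖x‖⁻¹ dM. -/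
open MeasureTheory Set

/-- If `M A = Mt A + ∫_(0,1) (t • M) A dt` on measurable sets, the same identity holds for
integrals of nonnegative measurable functions. -/
theorem lintegral_eq_add_lintegral_smul {E : Type*} [NormedAddCommGroup E] [NormedSpace ℝ E]
    [SecondCountableTopology E] [MeasurableSpace E] [BorelSpace E]
    {M Mt : Measure E} [SFinite M]
    (hM : ∀ A : Set E, MeasurableSet A →
      M A = Mt A + ∫⁻ t in Ioo (0:ℝ) 1, Measure.map (fun x : E => t • x) M A)
    {f : E → ENNReal} (hf : Measurable f) :
    ∫⁻ x, f x ∂M = ∫⁻ x, f x ∂Mt + ∫⁻ t in Ioo (0:ℝ) 1, ∫⁻ x, f (t • x) ∂M := by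
  have hsmul (t : ℝ) : Measurable (fun x : E => t • x) := by fun_prop
  have hmeas {g : E → ENNReal} (hg : Measurable g) :
      Measurable (fun t : ℝ => ∫⁻ x, g (t • x) ∂M) :=
    Measurable.lintegral_prod_right' (f := fun p : ℝ × E => g (p.1 • p.2))
      (hg.comp (continuous_fst.smul continuous_snd).measurable)
  refine Measurable.ennreal_induction
    (motive := fun f : E → ENNReal => ∫⁻ x, f x ∂M
      = ∫⁻ x, f x ∂Mt + ∫⁻ t in Ioo (0:ℝ) 1, ∫⁻ x, f (t • x) ∂M) ?_ ?_ ?_ hf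
  · intro c s hs
    have h (t : ℝ) : ∫⁻ x, s.indicator (fun _ => c) (t • x) ∂M
        = c * Measure.map (fun x : E => t • x) M s := by
      rw [← lintegral_map (measurable_const.indicator hs) (hsmul t),
        lintegral_indicator_const hs]
    have h' : Measurable (fun t : ℝ => Measure.map (fun x : E => t • x) M s) := by
      have := hmeas (measurable_const (a := (1 : ENNReal)) |>.indicator hs)
      convert this using 2 with t
      rw [← lintegral_map (measurable_const.indicator hs) (hsmul t),
        lintegral_indicator_const hs, one_mul]
    simp_rw [h]
    rw [lintegral_const_mul _ h', lintegral_indicator_const hs, lintegral_indicator_const hs,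
      hM s hs, mul_add]
  · intro f g _ hf hg ihf ihg
    have h (t : ℝ) : ∫⁻ x, (f + g) (t • x) ∂M
        = ∫⁻ x, f (t • x) ∂M + ∫⁻ x, g (t • x) ∂M :=
      lintegral_add_left (hf.comp (hsmul t)) _
    simp_rw [h]
    rw [lintegral_add_left (hmeas hf)]
    simp only [Pi.add_apply]
    rw [lintegral_add_left hf, lintegral_add_left hf, ihf, ihg]
    ring
  · intro f hf hmono ih
    have h (t : ℝ) : ∫⁻ x, (⨆ n, f n (t • x)) ∂M = ⨆ n, ∫⁻ x, f n (t • x) ∂M :=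
      lintegral_iSup (fun n => (hf n).comp (hsmul t)) fun i j hij x => hmono hij _
    simp only [h]
    rw [lintegral_iSup hf hmono, lintegral_iSup hf hmono,
      lintegral_iSup (fun n => hmeas (hf n)) fun i j hij t =>
        lintegral_mono fun x => hmono hij _]
    simp_rw [ih]
    exact (ENNReal.iSup_add_iSup_of_monotone (fun i j hij => lintegral_mono (hmono hij))
      fun i j hij => lintegral_mono fun t => lintegral_mono fun x => hmono hij (t • x)).symm

/-- The integral over `1 < t * r ≤ m` of the logarithm of `t * r`. -/
theorem lintegral_Ioc_log_mul {r m : ℝ} (hr : 0 < r) (hm : 1 ≤ m) :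
    ∫⁻ t in Ioc (1 / r) (m / r), ENNReal.ofReal (Real.log (t * r))
      = ENNReal.ofReal ((m * Real.log m - m + 1) * r⁻¹) := by
  have hle : 1 / r ≤ m / r := by gcongr
  have hpos {t : ℝ} (ht : 1 / r ≤ t) : 1 ≤ t * r := by rwa [div_le_iff₀ hr] at ht
  have hint : IntervalIntegrable (fun t : ℝ => Real.log (t * r)) volume (1 / r) (m / r) := by
    refine ContinuousOn.intervalIntegrable fun t ht => ?_
    rw [uIcc_of_le hle] at ht
    have := hpos ht.1
    exact ContinuousAt.continuousWithinAt
      (ContinuousAt.log (by fun_prop) (by positivity))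
  rw [← ofReal_integral_eq_lintegral_ofReal
      ((intervalIntegrable_iff_integrableOn_Ioc_of_le hle).1 hint)
      ((ae_restrict_mem measurableSet_Ioc).mono fun t ht =>
        Real.log_nonneg (hpos ht.1.le)),
    ← intervalIntegral.integral_of_le hle,
    intervalIntegral.integral_comp_mul_right (fun s => Real.log s) hr.ne',
    div_mul_cancel₀ _ hr.ne', div_mul_cancel₀ _ hr.ne', integral_log]
  congr 1
  simp
  ring

/-- The averages over dilations of the logarithm truncated to `1 < s ≤ k`. -/
theorem lintegral_Ioo_indicator_log_mul {r k : ℝ} (hr : 0 ≤ r) (hk : 1 < k) :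
    ∫⁻ t in Ioo (0:ℝ) 1, (Ioc 1 k).indicator (fun s => ENNReal.ofReal (Real.log s)) (t * r)
      = (Ioc 1 k).indicator (fun s => ENNReal.ofReal (Real.log s - (1 - s⁻¹))) r
        + ENNReal.ofReal (k * Real.log k - k + 1)
          * (Ioi k).indicator (fun s => ENNReal.ofReal s⁻¹) r := by
  rw [setLIntegral_congr Ioo_ae_eq_Ioc]
  rcases le_or_gt r 1 with h1 | h1
  · rw [indicator_of_notMem (by simp [h1]), indicator_of_notMem (by simp; linarith)]
    rw [setLIntegral_congr_fun (g := fun _ => 0) measurableSet_Ioc]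
    · simp
    · intro t ht
      refine indicator_of_notMem (fun h => ?_) _
      have := h.1
      have := ht.2
      nlinarith
  have hr0 : 0 < r := by linarith
  have key {m : ℝ} (hm : m ≤ r)
      (hiff : ∀ t : ℝ, t ≤ 1 → (t * r ≤ k ↔ t * r ≤ m)) :
      ∫⁻ t in Ioc (0:ℝ) 1, (Ioc 1 k).indicator (fun s => ENNReal.ofReal (Real.log s)) (t * r)
        = ∫⁻ t in Ioc (1 / r) (m / r), ENNReal.ofReal (Real.log (t * r)) := by
    have hset : Ioc (0:ℝ) 1 ∩ (fun t => t * r) ⁻¹' Ioc 1 k = Ioc (1 / r) (m / r) := by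
      ext t
      simp only [mem_inter_iff, mem_Ioc, mem_preimage, div_lt_iff₀ hr0, le_div_iff₀ hr0]
      constructor
      · rintro ⟨⟨_, h⟩, h2, h3⟩
        exact ⟨h2, (hiff t h).1 h3⟩
      · rintro ⟨h2, h3⟩
        have h4 : t ≤ 1 := by nlinarith
        exact ⟨⟨by nlinarith, h4⟩, h2, (hiff t h4).2 h3⟩
    rw [← hset, inter_comm, ← setLIntegral_indicator
      ((by fun_prop : Measurable fun t : ℝ => t * r) measurableSet_Ioc)]
    rfl
  rcases le_or_gt r k with h2 | h2
  · rw [key le_rfl fun t ht => ⟨fun _ => by nlinarith, fun h => h.trans h2⟩,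
      lintegral_Ioc_log_mul hr0 h1.le, indicator_of_mem (by exact ⟨h1, h2⟩),
      indicator_of_notMem (by simpa using h2), mul_zero, add_zero]
    congr 1
    field_simp
    ring
  · have hc : 0 ≤ k * Real.log k - k + 1 := by
      have := Real.one_sub_inv_le_log_of_pos (by linarith : 0 < k)
      have h3 : k * (1 - k⁻¹) ≤ k * Real.log k := by gcongr
      have h4 : k * (1 - k⁻¹) = k - 1 := by field_simp
      linarith
    rw [key h2.le fun t _ => Iff.rfl,
      lintegral_Ioc_log_mul hr0 hk.le, indicator_of_notMem (by simp [h2]),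
      indicator_of_mem (by exact h2), zero_add, ENNReal.ofReal_mul hc]

/-- Intermediate identity in the proof of finiteness of the
logarithmic moment: assume `M({x : ‖x‖>1}) < ∞` and let `M̃` be a Borel measure
on `E` such that `M(A) = M̃(A) + ∫_(0,1) M(t⁻¹A) dt` for every Borel set `A`
(recall `M(t⁻¹A)` is the image measure of `M` under `x ↦ t•x` evaluated at
`A`). Then for every `k > 1`,
`∫_{1<‖x‖≤k} log‖x‖ dM̃
  = ∫_{1<‖x‖≤k} (1 − ‖x‖⁻¹) dM − (k·log k − k + 1) · ∫_{‖x‖>k} ‖x‖⁻¹ dM`. -/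
theorem intermediate_log_identity {E : Type*} [NormedAddCommGroup E] [NormedSpace ℝ E]
    [CompleteSpace E] [SecondCountableTopology E] [MeasurableSpace E] [BorelSpace E]
    (M : Measure E) [SigmaFinite M]
    (hfin : M {x : E | 1 < ‖x‖} < ⊤)
    (Mt : Measure E)
    (hM : ∀ A : Set E, MeasurableSet A →
      M A = Mt A + ∫⁻ t in Ioo (0:ℝ) 1, Measure.map (fun x : E => t • x) M A) :
    ∀ k : ℝ, 1 < k →
      (∫⁻ x in {x : E | 1 < ‖x‖ ∧ ‖x‖ ≤ k}, ENNReal.ofReal (Real.log ‖x‖) ∂Mt) =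
        (∫⁻ x in {x : E | 1 < ‖x‖ ∧ ‖x‖ ≤ k}, ENNReal.ofReal (1 - ‖x‖⁻¹) ∂M) -
          ENNReal.ofReal (k * Real.log k - k + 1) *
            ∫⁻ x in {x : E | k < ‖x‖}, ENNReal.ofReal ‖x‖⁻¹ ∂M := by
  intro k hk
  have hnorm : Measurable fun x : E => ‖x‖ := measurable_norm
  have hS : MeasurableSet {x : E | 1 < ‖x‖ ∧ ‖x‖ ≤ k} := hnorm measurableSet_Ioc
  have hT : MeasurableSet {x : E | k < ‖x‖} := hnorm measurableSet_Ioi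
  set S := {x : E | 1 < ‖x‖ ∧ ‖x‖ ≤ k}
  set T := {x : E | k < ‖x‖} with hTdef
  set c := ENNReal.ofReal (k * Real.log k - k + 1)
  have hSfin : M S ≠ ⊤ := ((measure_mono fun x hx => hx.1).trans_lt hfin).ne
  have hTfin : M T ≠ ⊤ := ((measure_mono fun x hx => hk.trans hx).trans_lt hfin).ne
  have hlog : Measurable ((Ioc 1 k).indicator fun s => ENNReal.ofReal (Real.log s)) :=
    Measurable.indicator (by fun_prop) measurableSet_Ioc
  have hdis := lintegral_eq_add_lintegral_smul hM (hlog.comp hnorm)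
  have hswap : ∫⁻ t in Ioo (0:ℝ) 1, ∫⁻ x, ((Ioc 1 k).indicator
        (fun s => ENNReal.ofReal (Real.log s)) ∘ fun x : E => ‖x‖) (t • x) ∂M
      = ∫⁻ x in S, ENNReal.ofReal (Real.log ‖x‖ - (1 - ‖x‖⁻¹)) ∂M
        + c * ∫⁻ x in T, ENNReal.ofReal ‖x‖⁻¹ ∂M := by
    have hjoint : Measurable fun p : ℝ × E => ((Ioc 1 k).indicator
        (fun s => ENNReal.ofReal (Real.log s)) ∘ fun x : E => ‖x‖) (p.1 • p.2) :=
      (hlog.comp hnorm).comp (continuous_fst.smul continuous_snd).measurable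
    rw [lintegral_lintegral_swap (by exact hjoint.aemeasurable),
      ← lintegral_const_mul _ (by fun_prop), ← lintegral_indicator hS,
      ← lintegral_indicator hT, ← lintegral_add_left
        (Measurable.indicator (by fun_prop) hS)]
    refine lintegral_congr fun x => ?_
    rw [setLIntegral_congr_fun (g := fun t => (Ioc 1 k).indicator
      (fun s => ENNReal.ofReal (Real.log s)) (t * ‖x‖)) measurableSet_Ioo fun t ht => by
        simp only [Function.comp_apply, norm_smul, Real.norm_of_nonneg ht.1.le],
      lintegral_Ioo_indicator_log_mul (norm_nonneg x) hk]
    congr 1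
    by_cases h : k < ‖x‖ <;> simp [indicator, hTdef, h, c]
  have hind (μ : Measure E) : ∫⁻ x, ((Ioc 1 k).indicator
        (fun s => ENNReal.ofReal (Real.log s)) ∘ fun x : E => ‖x‖) x ∂μ
      = ∫⁻ x in S, ENNReal.ofReal (Real.log ‖x‖) ∂μ := by
    rw [← lintegral_indicator hS]
    rfl
  have hsplit : ∫⁻ x in S, ENNReal.ofReal (Real.log ‖x‖) ∂M
      = ∫⁻ x in S, ENNReal.ofReal (Real.log ‖x‖ - (1 - ‖x‖⁻¹)) ∂M
        + ∫⁻ x in S, ENNReal.ofReal (1 - ‖x‖⁻¹) ∂M := by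
    rw [← lintegral_add_left (by fun_prop)]
    refine setLIntegral_congr_fun hS fun x hx => ?_
    have h0 : 0 < ‖x‖ := one_pos.trans hx.1
    have h1 := Real.one_sub_inv_le_log_of_pos h0
    have h2 := inv_le_one_of_one_le₀ hx.1.le
    rw [← ENNReal.ofReal_add (by linarith) (by linarith), sub_add_cancel]
  have hfinS : ∫⁻ x in S, ENNReal.ofReal (Real.log ‖x‖ - (1 - ‖x‖⁻¹)) ∂M ≠ ⊤ := by
    refine (setLIntegral_lt_top_of_le_nnreal hSfin ⟨(Real.log k).toNNReal, fun x hx => ?_⟩).ne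
    refine ENNReal.ofReal_le_ofReal ?_
    have h0 : 0 < ‖x‖ := one_pos.trans hx.1
    have h2 := inv_le_one_of_one_le₀ hx.1.le
    have h3 := Real.log_le_log h0 hx.2
    linarith
  have hfinT : ∫⁻ x in T, ENNReal.ofReal ‖x‖⁻¹ ∂M ≠ ⊤ := by
    refine (setLIntegral_lt_top_of_le_nnreal hTfin ⟨1, fun x hx => ?_⟩).ne
    simpa using inv_le_one_of_one_le₀ (hk.trans hx).le
  rw [hswap, hind, hind, hsplit, add_left_comm] at hdis
  exact ENNReal.eq_sub_of_add_eq (ENNReal.mul_ne_top ENNReal.ofReal_ne_top hfinT)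
    ((ENNReal.add_right_inj hfinS).1 hdis).symm
end

section
/- Finite logarithmic moment of the residual measure: assume M({x : ‖x‖>1}) < ∞ and let M̃ be a Borel measure on E such that M(A) = M̃(A) + ∫_(0,1) M(t⁻¹A) dt for every Borel set A. Then ∫_{‖x‖>1} log‖x‖ dM̃ ≤ M({x : ‖x‖>1}) < ∞. -/
open MeasureTheory Set

theorem lintegral_neg_log_Ioo :
    ∫⁻ t in Ioo (0 : ℝ) 1, ENNReal.ofReal (-Real.log t) = 1 := by
  have hint : IntegrableOn (fun t : ℝ => -Real.log t) (Ioc 0 1) :=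
    (intervalIntegrable_iff_integrableOn_Ioc_of_le zero_le_one).1
      intervalIntegral.intervalIntegrable_log'.neg
  have hval : ∫ t in Ioc (0 : ℝ) 1, -Real.log t = 1 := by
    rw [← intervalIntegral.integral_of_le zero_le_one, intervalIntegral.integral_neg,
      integral_log]
    simp
  rw [restrict_Ioo_eq_restrict_Ioc, ← ofReal_integral_eq_lintegral_ofReal hint, hval,
    ENNReal.ofReal_one]
  filter_upwards [ae_restrict_mem measurableSet_Ioc] with t ht
  simpa using Real.log_nonpos ht.1.le ht.2

/-- The truncation at height `n` of the positive part of the logarithm. -/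
noncomputable def truncLog (n : ℕ) (r : ℝ) : ENNReal :=
  min (ENNReal.ofReal (Real.log r)) n

theorem measurable_truncLog (n : ℕ) : Measurable (truncLog n) :=
  Real.measurable_log.ennreal_ofReal.min measurable_const

theorem truncLog_eq_zero (n : ℕ) {r : ℝ} (h0 : 0 ≤ r) (h1 : r ≤ 1) : truncLog n r = 0 := by
  simp [truncLog, ENNReal.ofReal_of_nonpos (Real.log_nonpos h0 h1)]

theorem truncLog_le_add (n : ℕ) {r t : ℝ} (hr : 0 < r) (ht : 0 < t) :
    truncLog n r ≤ truncLog n (t * r) + ENNReal.ofReal (-Real.log t) := by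
  have hlog : Real.log r = Real.log (t * r) + -Real.log t := by
    rw [Real.log_mul ht.ne' hr.ne']; ring
  unfold truncLog
  rw [min_add]
  refine min_le_min ?_ le_self_add
  rw [hlog]
  exact ENNReal.ofReal_add_le

theorem truncLog_le_lintegral_add_one (n : ℕ) {r : ℝ} (hr : 0 < r) :
    truncLog n r ≤ (∫⁻ t in Ioo (0 : ℝ) 1, truncLog n (t * r)) + 1 := by
  calc truncLog n r = ∫⁻ _ in Ioo (0 : ℝ) 1, truncLog n r := by simp
    _ ≤ ∫⁻ t in Ioo (0 : ℝ) 1, (truncLog n (t * r) + ENNReal.ofReal (-Real.log t)) :=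
        setLIntegral_mono' measurableSet_Ioo fun t ht => truncLog_le_add n hr ht.1
    _ = _ := by
        have hmeas : Measurable fun t : ℝ => truncLog n (t * r) :=
          (measurable_truncLog n).comp (measurable_id.mul_const r)
        rw [lintegral_add_left hmeas, lintegral_neg_log_Ioo]

theorem iSup_truncLog (r : ℝ) : ⨆ n, truncLog n r = ENNReal.ofReal (Real.log r) := by
  simp only [truncLog, ← inf_iSup_eq, ENNReal.iSup_natCast, inf_top_eq]

theorem monotone_truncLog (r : ℝ) : Monotone fun n => truncLog n r :=
  fun _ _ h => min_le_min le_rfl (Nat.cast_le.2 h)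

section

variable {E : Type*} [NormedAddCommGroup E] [NormedSpace ℝ E] [SecondCountableTopology E]
  [MeasurableSpace E] [BorelSpace E]

theorem eq_add_map_smul_prod {M Mt : Measure E} [SigmaFinite M]
    (hM : ∀ A : Set E, MeasurableSet A →
      M A = Mt A + ∫⁻ t in Ioo (0:ℝ) 1, Measure.map (fun x : E => t • x) M A) :
    M = Mt + ((volume.restrict (Ioo (0 : ℝ) 1)).prod M).map fun p => p.1 • p.2 := by
  ext A hA
  have hsmul : Measurable fun p : ℝ × E => p.1 • p.2 := measurable_fst.smul measurable_snd
  rw [hM A hA, Measure.add_apply, Measure.map_apply hsmul hA, Measure.prod_apply (hsmul hA)]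
  congr 1
  refine lintegral_congr fun t => ?_
  rw [Measure.map_apply (measurable_const_smul t) hA]
  rfl

theorem lintegral_truncLog_le {M Mt : Measure E} [SigmaFinite M]
    (hfin : M {x : E | 1 < ‖x‖} < ⊤)
    (hM : M = Mt + ((volume.restrict (Ioo (0 : ℝ) 1)).prod M).map fun p => p.1 • p.2) (n : ℕ) :
    ∫⁻ x, truncLog n ‖x‖ ∂Mt ≤ M {x : E | 1 < ‖x‖} := by
  have hS : MeasurableSet {x : E | 1 < ‖x‖} := measurableSet_lt measurable_const measurable_norm
  have hsmul : Measurable fun p : ℝ × E => p.1 • p.2 := measurable_fst.smul measurable_snd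
  have hmeas : Measurable fun x : E => truncLog n ‖x‖ :=
    (measurable_truncLog n).comp measurable_norm
  have hmeas_smul : Measurable fun p : ℝ × E => truncLog n ‖p.1 • p.2‖ := hmeas.comp hsmul
  set I := ∫⁻ x : E, (∫⁻ t in Ioo (0 : ℝ) 1, truncLog n (t * ‖x‖)) ∂M
  have hsplit : ∫⁻ x, truncLog n ‖x‖ ∂M = (∫⁻ x, truncLog n ‖x‖ ∂Mt) + I := by
    conv_lhs => rw [hM]
    rw [lintegral_add_measure, lintegral_map hmeas hsmul,
      lintegral_prod_symm _ hmeas_smul.aemeasurable]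
    congr 1
    refine lintegral_congr fun x => setLIntegral_congr_fun measurableSet_Ioo fun t ht => ?_
    simp [norm_smul, abs_of_pos ht.1]
  have hM_fin : ∫⁻ x, truncLog n ‖x‖ ∂M < ⊤ := by
    calc ∫⁻ x, truncLog n ‖x‖ ∂M
        ≤ ∫⁻ x, {x : E | 1 < ‖x‖}.indicator (fun _ => (n : ENNReal)) x ∂M := by
          refine lintegral_mono fun x => ?_
          by_cases hx : 1 < ‖x‖
          · simp [hx, truncLog]
          · simp [hx, truncLog_eq_zero n (norm_nonneg x) (not_lt.1 hx)]
      _ = n * M {x : E | 1 < ‖x‖} := lintegral_indicator_const hS _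
      _ < ⊤ := ENNReal.mul_lt_top (ENNReal.natCast_lt_top n) hfin
  have hI_fin : I ≠ ⊤ := ((le_add_self.trans hsplit.ge).trans_lt hM_fin).ne
  have hle : ∫⁻ x, truncLog n ‖x‖ ∂M ≤ M {x : E | 1 < ‖x‖} + I := by
    calc ∫⁻ x, truncLog n ‖x‖ ∂M
        ≤ ∫⁻ x, ({x : E | 1 < ‖x‖}.indicator 1 x
            + ∫⁻ t in Ioo (0 : ℝ) 1, truncLog n (t * ‖x‖)) ∂M := by
          refine lintegral_mono fun x => ?_
          by_cases hx : 1 < ‖x‖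
          · simpa [hx, add_comm] using
              truncLog_le_lintegral_add_one n (zero_lt_one.trans hx)
          · simp [truncLog_eq_zero n (norm_nonneg x) (not_lt.1 hx)]
      _ = _ := by
          rw [lintegral_add_left (measurable_one.indicator hS), lintegral_indicator_one hS]
  rw [hsplit] at hle
  exact (ENNReal.add_le_add_iff_right hI_fin).1 hle

end

/-- Finite logarithmic moment of the residual measure: assume
`M({x : ‖x‖>1}) < ∞` and let `M̃` be a Borel measure on `E` such that
`M(A) = M̃(A) + ∫_(0,1) M(t⁻¹A) dt` for every Borel set `A` (recall `M(t⁻¹A)`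
is the image measure of `M` under `x ↦ t•x` evaluated at `A`). Then
`∫_{‖x‖>1} log‖x‖ dM̃ ≤ M({x : ‖x‖>1}) < ∞`. -/
theorem residual_log_moment_finite {E : Type*} [NormedAddCommGroup E] [NormedSpace ℝ E]
    [CompleteSpace E] [SecondCountableTopology E] [MeasurableSpace E] [BorelSpace E]
    (M : Measure E) [SigmaFinite M]
    (hfin : M {x : E | 1 < ‖x‖} < ⊤)
    (Mt : Measure E)
    (hM : ∀ A : Set E, MeasurableSet A →
      M A = Mt A + ∫⁻ t in Ioo (0:ℝ) 1, Measure.map (fun x : E => t • x) M A) :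
    (∫⁻ x in {x : E | 1 < ‖x‖}, ENNReal.ofReal (Real.log ‖x‖) ∂Mt) ≤
        M {x : E | 1 < ‖x‖} ∧
      M {x : E | 1 < ‖x‖} < ⊤ := by
  refine ⟨?_, hfin⟩
  calc ∫⁻ x in {x : E | 1 < ‖x‖}, ENNReal.ofReal (Real.log ‖x‖) ∂Mt
      ≤ ∫⁻ x, ENNReal.ofReal (Real.log ‖x‖) ∂Mt := setLIntegral_le_lintegral _ _
    _ = ⨆ n, ∫⁻ x, truncLog n ‖x‖ ∂Mt := by
        have hmeas (n : ℕ) : Measurable fun x : E => truncLog n ‖x‖ :=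
          (measurable_truncLog n).comp measurable_norm
        rw [← lintegral_iSup hmeas fun _ _ h x => monotone_truncLog ‖x‖ h]
        simp only [iSup_truncLog]
    _ ≤ M {x : E | 1 < ‖x‖} :=
        iSup_le fun n => lintegral_truncLog_le hfin (eq_add_map_smul_prod hM) n
end
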